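/- arXiv:2502.01604 — 2 statements merged into one kernel-verified Lean document; each statement's English description precedes it below -/
import Mathlib

section
/- Let (P, ≤) be a finite partially ordered set and let S ⊆ A₂(P) = {(x,y) : x ∥ y} be an order filter of (A₂(P), ⪯_A) (i.e., an upper set: if p ∈ S and p ⪯_A q then q ∈ S) satisfying (x,y) ∈ S if and only if (y,x) ∉ S, for every (x,y) ∈ A₂(P). Then the function π_S defined by π_S(x,y) = 1 if x ≤ y or (x,y) ∈ S, and π_S(x,y) = 0 otherwise, is a probability function on P, and π_S is an extreme point of the convex set of all probability functions on P. -/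
/-- A probability function on a poset `P` (Kim–Kim–Neggers): a function
`π : P × P → ℝ` with values in `[0,1]` such that `π(x,x) = 1`, `x ≤ y` implies
`π(x,y) = 1`, `x ≠ y` implies `π(x,y) + π(y,x) = 1`, and `y < z` implies
`π(x,y) ≤ π(x,z)`. -/
def IsProbFunc {P : Type*} [PartialOrder P] (π : P → P → ℝ) : Prop :=
  (∀ x y : P, 0 ≤ π x y ∧ π x y ≤ 1) ∧
  (∀ x : P, π x x = 1) ∧
  (∀ x y : P, x ≤ y → π x y = 1) ∧
  (∀ x y : P, x ≠ y → π x y + π y x = 1) ∧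
  (∀ x y z : P, y < z → π x y ≤ π x z)


/-- The relation `≤_A` on ordered pairs of incomparable elements of `P`:
`(x,y) ≤_A (u,v)` iff both pairs are incomparable and (`x = u` and `y ≤ v`)
or (`y = v` and `u ≤ x`). Its reflexive-transitive closure is `⪯_A`. -/
def leA {P : Type*} [PartialOrder P] (p q : P × P) : Prop :=
  (¬p.1 ≤ p.2 ∧ ¬p.2 ≤ p.1) ∧ (¬q.1 ≤ q.2 ∧ ¬q.2 ≤ q.1) ∧
  ((p.1 = q.1 ∧ p.2 ≤ q.2) ∨ (p.2 = q.2 ∧ q.1 ≤ p.1))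

/-- A probability function taking only the values `0` and `1` is an extreme point of the set of
probability functions. -/
theorem IsProbFunc.mem_extremePoints_of_zero_or_one {P : Type*} [PartialOrder P] {π : P → P → ℝ}
    (hπ : IsProbFunc π) (h01 : ∀ x y, π x y = 0 ∨ π x y = 1) :
    π ∈ Set.extremePoints ℝ {π : P → P → ℝ | IsProbFunc π} := by
  refine mem_extremePoints_iff_left.2 ⟨hπ, ?_⟩
  rintro f hf g hg ⟨a, b, ha, hb, hab, rfl⟩
  ext x y
  obtain ⟨hf0, hf1⟩ := hf.1 x y
  obtain ⟨hg0, hg1⟩ := hg.1 x y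
  have h := h01 x y
  simp only [Pi.add_apply, Pi.smul_apply, smul_eq_mul] at h ⊢
  rcases h with h | h <;> rw [h] <;> nlinarith

open Classical in
/-- The indicator of the order together with a complementary order filter of incomparable pairs is
a probability function. -/
theorem isProbFunc_of_filter {P : Type*} [PartialOrder P] (S : Set (P × P))
    (hSsub : ∀ p ∈ S, ¬p.1 ≤ p.2 ∧ ¬p.2 ≤ p.1)
    (hfilter : ∀ p ∈ S, ∀ q, Relation.ReflTransGen leA p q → q ∈ S)
    (hcompl : ∀ x y : P, ¬x ≤ y → ¬y ≤ x → ((x, y) ∈ S ↔ (y, x) ∉ S)) :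
    IsProbFunc (fun x y : P => if x ≤ y ∨ (x, y) ∈ S then (1 : ℝ) else 0) := by
  refine ⟨fun x y => ?_, fun x => by simp, fun x y h => by simp [h], fun x y hne => ?_,
    fun x y z hyz => ?_⟩
  · dsimp only
    split_ifs <;> norm_num
  · dsimp only
    have hxy := hSsub (x, y)
    have hyx := hSsub (y, x)
    have hc := hcompl x y
    have ha : x ≤ y → ¬y ≤ x := fun h h' => hne (le_antisymm h h')
    split_ifs <;> first | (norm_num; done) | (exfalso; tauto)
  · dsimp only
    have himp : x ≤ y ∨ (x, y) ∈ S → x ≤ z ∨ (x, z) ∈ S := by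
      rintro (h | h)
      · exact Or.inl (h.trans hyz.le)
      · have hinc := hSsub _ h
        by_cases hxz : x ≤ z
        · exact Or.inl hxz
        · exact Or.inr (hfilter _ h _ (.single
            ⟨hinc, ⟨hxz, fun hzx => hinc.2 (hyz.le.trans hzx)⟩, Or.inl ⟨rfl, hyz.le⟩⟩))
    split_ifs <;> first | (norm_num; done) | (exfalso; tauto)

open Classical in
/-- If `S ⊆ A₂(P)` is an order filter of `(A₂(P), ⪯_A)` satisfying
`(x,y) ∈ S ↔ (y,x) ∉ S` for incomparable `x, y`, then
`π_S(x,y) = 1` if `x ≤ y` or `(x,y) ∈ S`, else `0`, is a probability function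
on `P` and an extreme point of the convex set of probability functions. -/
theorem stmt_17 {P : Type*} [PartialOrder P] [Fintype P] (S : Set (P × P))
    (hSsub : ∀ p ∈ S, ¬p.1 ≤ p.2 ∧ ¬p.2 ≤ p.1)
    (hfilter : ∀ p ∈ S, ∀ q, Relation.ReflTransGen leA p q → q ∈ S)
    (hcompl : ∀ x y : P, ¬x ≤ y → ¬y ≤ x → ((x, y) ∈ S ↔ (y, x) ∉ S)) :
    IsProbFunc (fun x y : P => if x ≤ y ∨ (x, y) ∈ S then (1 : ℝ) else 0) ∧
    (fun x y : P => if x ≤ y ∨ (x, y) ∈ S then (1 : ℝ) else 0) ∈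
      Set.extremePoints ℝ {π : P → P → ℝ | IsProbFunc π} := by
  have hπ := isProbFunc_of_filter S hSsub hfilter hcompl
  refine ⟨hπ, hπ.mem_extremePoints_of_zero_or_one fun x y => ?_⟩
  split_ifs <;> simp
end

section
/- Let (P, ≤) be a finite partially ordered set and let π be a probability function on P all of whose values lie in {0,1}. Then the set S = {(x,y) ∈ A₂(P) : π(x,y) = 1} is an order filter of (A₂(P), ⪯_A) satisfying (x,y) ∈ S if and only if (y,x) ∉ S, for every (x,y) ∈ A₂(P). -/
/-- If `π` is a probability function on a finite poset `P` with all values in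
`{0,1}`, then `S = {(x,y) ∈ A₂(P) : π(x,y) = 1}` is an order filter of
`(A₂(P), ⪯_A)` satisfying `(x,y) ∈ S ↔ (y,x) ∉ S` for every `(x,y) ∈ A₂(P)`. -/
theorem stmt_18 {P : Type*} [PartialOrder P] [Fintype P] (π : P → P → ℝ)
    (hπ : IsProbFunc π) (h01 : ∀ x y : P, π x y = 0 ∨ π x y = 1) :
    (∀ p ∈ {p : P × P | (¬p.1 ≤ p.2 ∧ ¬p.2 ≤ p.1) ∧ π p.1 p.2 = 1},
      ∀ q, Relation.ReflTransGen leA p q →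
        q ∈ {p : P × P | (¬p.1 ≤ p.2 ∧ ¬p.2 ≤ p.1) ∧ π p.1 p.2 = 1}) ∧
    (∀ x y : P, ¬x ≤ y → ¬y ≤ x →
      ((x, y) ∈ {p : P × P | (¬p.1 ≤ p.2 ∧ ¬p.2 ≤ p.1) ∧ π p.1 p.2 = 1} ↔
       (y, x) ∉ {p : P × P | (¬p.1 ≤ p.2 ∧ ¬p.2 ≤ p.1) ∧ π p.1 p.2 = 1})) := by
  obtain ⟨-, -, -, hadd, hmono⟩ := hπ
  have le_right : ∀ x {y z : P}, y ≤ z → π x y ≤ π x z := fun x y z h =>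
    h.eq_or_lt.elim (fun h => h ▸ le_rfl) (hmono x y z)
  constructor
  · intro p hp q hpq
    induction hpq with
    | refl => exact hp
    | @tail b c _ hbc ih =>
      obtain ⟨b₁, b₂⟩ := b
      obtain ⟨c₁, c₂⟩ := c
      obtain ⟨-, hb⟩ := ih
      obtain ⟨hb', hc, h⟩ := hbc
      refine ⟨hc, (h01 c₁ c₂).resolve_left fun h0 => ?_⟩
      dsimp only at hb hb' hc h
      rcases h with ⟨rfl, h⟩ | ⟨rfl, h⟩
      · linarith [le_right b₁ h]
      · linarith [le_right b₂ h, hadd b₁ b₂ fun e => hb'.1 e.le,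
          hadd c₁ b₂ fun e => hc.1 e.le]
  · intro x y hxy hyx
    have hsum := hadd x y fun e => hxy e.le
    constructor
    · rintro ⟨-, h⟩ ⟨-, h'⟩
      dsimp only at h h'
      linarith
    · intro h
      refine ⟨⟨hxy, hyx⟩, (h01 x y).resolve_left fun h0 => h ⟨⟨hyx, hxy⟩, ?_⟩⟩
      dsimp only
      linarith
end
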